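/- Let α be a partition of n and β a one-box-shift of α with β_a = α_a − 1 and β_b = α_b + 1 for a < b, and let θ̂ := Σ_T ((−1)^{|T|} ∏_{u ∈ {R}∖{T}} h_u) θ̂_T : S^α → M^β be defined over ℤ, the sum running over all semistandard α-tableaux T of type β. Let γ be the partition of n given by the composition (α_1, …, α_a, α_{a+1} − 1, α_{a+2}, …, α_{b−1}, α_b + 1, α_{b+1}, …), so that ψ_a := ψ_{a, β_{a+1}−1} maps M^β to M^γ. Then the image of θ̂ ∘ ψ_a is contained in h_a · M_ℤ^γ. -/

import Mathlib

namespace CarterPayne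

open Finset

/-- A partition of `n`, presented by its parts function; rows are indexed from `1`. -/
structure Partition (n : ℕ) where
  parts : ℕ → ℕ
  parts_zero : parts 0 = 0
  antitone : ∀ ⦃i j : ℕ⦄, 0 < i → i ≤ j → parts j ≤ parts i
  finite_support : (Function.support parts).Finite
  sum_parts : ∑ᶠ i, parts i = n

variable {n : ℕ}

/-- The set of cells `(row, column)` (both 1-indexed) of the Young diagram of `μ`. -/
def Partition.cells (μ : Partition n) : Set (ℕ × ℕ) :=
  {c | 0 < c.1 ∧ 0 < c.2 ∧ c.2 ≤ μ.parts c.1}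

/-- A tabloid for the composition `c` of `n`: an assignment of the `n` symbols to rows
(rows indexed from 1), row `i` receiving exactly `c i` symbols. -/
def Tabloid (n : ℕ) (c : ℕ → ℕ) : Type :=
  {g : Fin n → ℕ // ∀ i, (Finset.univ.filter fun k => g k = i).card = c i}

/-- The permutation module `M^c` over `R`: the free `R`-module on the set of tabloids. -/
abbrev PermMod (R : Type*) [CommRing R] (n : ℕ) (c : ℕ → ℕ) := Tabloid n c →₀ R

/-- The action of a permutation of the symbols on tabloids. -/
def permTabloid (c : ℕ → ℕ) (π : Equiv.Perm (Fin n)) (f : Tabloid n c) : Tabloid n c :=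
  ⟨fun k => f.1 (π.symm k), fun i => by
    rw [← f.2 i]
    exact Finset.card_equiv π.symm fun a => by simp⟩

/-- The `R`-linear action of a permutation of the symbols on `M^c`. -/
noncomputable def permM (R : Type*) [CommRing R] (c : ℕ → ℕ) (π : Equiv.Perm (Fin n)) :
    PermMod R n c →ₗ[R] PermMod R n c :=
  Finsupp.lmapDomain R R (permTabloid c π)

/-- A bijective `μ`-tableau, presented by the placement map which sends each of the
`n` symbols to the cell of the Young diagram containing it. -/
structure Placement (μ : Partition n) where
  pos : Fin n → ℕ × ℕ
  mem : ∀ k, pos k ∈ μ.cells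
  inj : Function.Injective pos
  surj : ∀ c ∈ μ.cells, ∃ k, pos k = c

/-- The column stabilizer of a bijective tableau, as a set of permutations of the symbols. -/
def colStab {μ : Partition n} (T : Placement μ) : Finset (Equiv.Perm (Fin n)) :=
  Finset.univ.filter fun π => ∀ k, (T.pos (π k)).2 = (T.pos k).2

lemma rowFiber_card {μ : Partition n} (T : Placement μ) (i : ℕ) :
    (Finset.univ.filter fun k => (T.pos k).1 = i).card = μ.parts i := by
  classical
  have h : (Finset.univ.filter fun k => (T.pos k).1 = i).card
      = (Finset.Icc 1 (μ.parts i)).card := by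
    apply Finset.card_bij (fun k _ => (T.pos k).2)
    · intro a ha
      simp only [Finset.mem_filter, Finset.mem_univ, true_and] at ha
      obtain ⟨h1, h2, h3⟩ := T.mem a
      exact Finset.mem_Icc.mpr ⟨h2, ha ▸ h3⟩
    · intro a ha b hb hab
      simp only [Finset.mem_filter, Finset.mem_univ, true_and] at ha hb
      exact T.inj (Prod.ext (ha.trans hb.symm) hab)
    · intro j hj
      rw [Finset.mem_Icc] at hj
      have hi0 : 0 < i := by
        rcases Nat.eq_zero_or_pos i with h0 | h0
        · exfalso; rw [h0, μ.parts_zero] at hj; omega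
        · exact h0
      obtain ⟨k, hk⟩ := T.surj (i, j) ⟨hi0, hj.1, hj.2⟩
      exact ⟨k, by simp [hk], by simp [hk]⟩
  rw [h, Nat.card_Icc]
  omega

/-- The row tabloid `{tπ}` associated to the bijective tableau `tπ`. -/
def rowTabloid {μ : Partition n} (T : Placement μ) (π : Equiv.Perm (Fin n)) :
    Tabloid n μ.parts :=
  ⟨fun k => (T.pos (π k)).1, fun i => by
    rw [← rowFiber_card T i]
    exact Finset.card_equiv π fun a => by simp⟩

/-- The polytabloid `e_t` attached to a bijective tableau `t`. -/
noncomputable def polytabloid (R : Type*) [CommRing R] {μ : Partition n} (T : Placement μ) :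
    PermMod R n μ.parts :=
  ∑ π ∈ colStab T, ((Equiv.Perm.sign π : ℤ) : R) • Finsupp.single (rowTabloid T π) (1 : R)

/-- The Specht module `S^μ`, the span in `M^μ` of all polytabloids. -/
noncomputable def Specht (R : Type*) [CommRing R] (μ : Partition n) :
    Submodule R (PermMod R n μ.parts) :=
  Submodule.span R (Set.range fun T : Placement μ => polytabloid R T)

/-- `β` is obtained from the partition `α` of `n` by moving one box from
(the end of) row `a` to (the end of) row `b`; i.e. `β` is a one-box-shift of `α`. -/
structure OneBoxShift {n : ℕ} (α β : Partition n) (a b : ℕ) : Prop where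
  a_pos : 0 < a
  a_lt_b : a < b
  rem : α.parts (a + 1) < α.parts a
  add : α.parts b < α.parts (b - 1)
  at_a : β.parts a = α.parts a - 1
  at_b : β.parts b = α.parts b + 1
  elsewhere : ∀ i, i ≠ a → i ≠ b → β.parts i = α.parts i

-- finiteness of the set of tabloids
lemma tabloid_finite (n : ℕ) (c : ℕ → ℕ) :
    {g : Fin n → ℕ | ∀ i, (Finset.univ.filter fun k => g k = i).card = c i}.Finite := by
  classical
  rcases Set.eq_empty_or_nonempty
      {g : Fin n → ℕ | ∀ i, (Finset.univ.filter fun k => g k = i).card = c i} with h | ⟨g₀, hg₀⟩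
  · rw [h]; exact Set.finite_empty
  · apply Set.Finite.subset (Set.Finite.pi fun _ : Fin n => Set.finite_range g₀)
    intro g hg
    simp only [Set.mem_pi, Set.mem_univ, forall_true_left]
    intro k
    have h1 : (Finset.univ.filter fun k' => g k' = g k).card = c (g k) := hg (g k)
    have h2 : (Finset.univ.filter fun k' => g₀ k' = g k).card = c (g k) := hg₀ (g k)
    have hp : 0 < c (g k) := by
      rw [← h1]
      exact Finset.card_pos.mpr ⟨k, by simp⟩
    rw [← h2] at hp
    obtain ⟨k', hk'⟩ := Finset.card_pos.mp hp
    simp only [Finset.mem_filter] at hk'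
    exact ⟨k', hk'.2⟩

noncomputable instance (c : ℕ → ℕ) : Fintype (Tabloid n c) :=
  (tabloid_finite n c).fintype

lemma cells_finite (μ : Partition n) : μ.cells.Finite := by
  apply Set.Finite.subset (μ.finite_support.prod (Set.finite_Icc 1 (μ.parts 1)))
  rintro ⟨i, j⟩ ⟨h1, h2, h3⟩
  refine Set.mem_prod.mpr ⟨?_, ?_⟩
  · simp only [Function.mem_support]
    intro h0
    rw [h0] at h3; omega
  · exact ⟨h2, le_trans h3 (μ.antitone Nat.one_pos h1)⟩

/-- The finset of cells of the Young diagram of `μ`. -/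
noncomputable def cellFinset (μ : Partition n) : Finset (ℕ × ℕ) := (cells_finite μ).toFinset

/-- An `α`-tableau (a filling of the diagram of `α` by natural numbers) has type `c`
if the entry `j` appears exactly `c j` times. -/
def IsTypeOf (α : Partition n) (c : ℕ → ℕ) (T : ℕ × ℕ → ℕ) : Prop :=
  ∀ j, ((cellFinset α).filter fun cc => T cc = j).card = c j

/-- A filling of the diagram of `α` is semistandard if its entries are nondecreasing
along rows and strictly increasing down columns. -/
def IsSemistandard (α : Partition n) (T : ℕ × ℕ → ℕ) : Prop :=
  (∀ i j j', (i, j) ∈ α.cells → (i, j') ∈ α.cells → j ≤ j' → T (i, j) ≤ T (i, j')) ∧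
  (∀ i i' j, (i, j) ∈ α.cells → (i', j) ∈ α.cells → i < i' → T (i, j) < T (i', j))

/-- Number of entries equal to `j` in row `i` of the `α`-tableau `T`. -/
def rowContent (α : Partition n) (T : ℕ × ℕ → ℕ) (i j : ℕ) : ℕ :=
  ((Finset.Icc 1 (α.parts i)).filter fun col => T (i, col) = j).card

open Classical in
/-- James' homomorphism `θ_T : M^α → M^c` attached to an `α`-tableau `T` of type `c`:
an `α`-tabloid `f` is sent to the sum of all `c`-tabloids `g` such that, for all `i`, `j`,
exactly `rowContent α T i j` symbols lie in row `i` of `f` and row `j` of `g`.  (This is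
the sum over the row-equivalence class of `T` of the corresponding tabloids.) -/
noncomputable def theta (R : Type*) [CommRing R] (α : Partition n) (c : ℕ → ℕ)
    (T : ℕ × ℕ → ℕ) : PermMod R n α.parts →ₗ[R] PermMod R n c :=
  Finsupp.lift (PermMod R n c) R (Tabloid n α.parts) fun f =>
    ∑ g ∈ Finset.univ.filter (fun g : Tabloid n c =>
        ∀ i j, (Finset.univ.filter fun k => f.1 k = i ∧ g.1 k = j).card = rowContent α T i j),
      Finsupp.single g (1 : R)

/-- The restriction `θ̂_T` of `θ_T` to the Specht module `S^α`. -/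
noncomputable def thetaHat (R : Type*) [CommRing R] (α : Partition n) (c : ℕ → ℕ)
    (T : ℕ × ℕ → ℕ) : ↥(Specht R α) →ₗ[R] PermMod R n c :=
  (theta R α c T).comp (Specht R α).subtype

/-- The composition `ν` obtained from `c` by replacing the rows `i`, `i+1` with rows of
sizes `c i + c (i+1) - r` and `r`. -/
def nuComp (c : ℕ → ℕ) (i r : ℕ) : ℕ → ℕ :=
  fun j => if j = i then c i + c (i + 1) - r else if j = i + 1 then r else c j

open Classical in
/-- James' homomorphism `ψ_{i,r} : M^c → M^ν`: a tabloid is sent to the sum of all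
tabloids obtained from it by changing all but `r` of the entries in row `i+1` to `i`. -/
noncomputable def psi (R : Type*) [CommRing R] (c : ℕ → ℕ) (i r : ℕ) :
    PermMod R n c →ₗ[R] PermMod R n (nuComp c i r) :=
  Finsupp.lift (PermMod R n (nuComp c i r)) R (Tabloid n c) fun f =>
    ∑ g ∈ Finset.univ.filter (fun g : Tabloid n (nuComp c i r) =>
        ∀ k, g.1 k = f.1 k ∨ (f.1 k = i + 1 ∧ g.1 k = i)),
      Finsupp.single g (1 : R)

/-- Normalized semistandard `α`-tableaux of type `c` (entries outside the diagram are `0`). -/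
def SSTSet (α : Partition n) (c : ℕ → ℕ) : Set (ℕ × ℕ → ℕ) :=
  {T | IsSemistandard α T ∧ IsTypeOf α c T ∧ ∀ cc, cc ∉ α.cells → T cc = 0}

lemma SSTSet_finite (α : Partition n) (c : ℕ → ℕ) (hc : (Function.support c).Finite) :
    (SSTSet α c).Finite := by
  classical
  have hinj : Set.InjOn (fun T (cc : ↥(cellFinset α)) => T cc.1) (SSTSet α c) := by
    intro T hT S hS h
    funext cc
    by_cases hcc : cc ∈ α.cells
    · have hmem : cc ∈ cellFinset α := (Set.Finite.mem_toFinset _).mpr hcc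
      exact congrFun h ⟨cc, hmem⟩
    · rw [hT.2.2 cc hcc, hS.2.2 cc hcc]
  have himage : ((fun T (cc : ↥(cellFinset α)) => T cc.1) '' SSTSet α c) ⊆
      Set.univ.pi (fun _ : ↥(cellFinset α) => insert 0 (Function.support c)) := by
    rintro _ ⟨T, hT, rfl⟩
    intro cc _
    have h1 := hT.2.1 (T cc.1)
    have h2 : cc.1 ∈ (cellFinset α).filter fun d => T d = T cc.1 :=
      Finset.mem_filter.mpr ⟨cc.2, rfl⟩
    have h3 : 0 < c (T cc.1) := h1 ▸ Finset.card_pos.mpr ⟨cc.1, h2⟩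
    exact Set.mem_insert_iff.mpr (Or.inr (by
      simp only [Function.mem_support]
      omega))
  exact Set.Finite.of_finite_image
    (Set.Finite.subset (Set.Finite.pi fun _ => hc.insert 0) himage) hinj

/-- The finset of all (normalized) semistandard `α`-tableaux of type `β`. -/
noncomputable def sstFinset (α β : Partition n) : Finset (ℕ × ℕ → ℕ) :=
  (SSTSet_finite α β.parts β.finite_support).toFinset

/-- `T̂(u)`, the entry at the end of row `u` of `T`. -/
def hatOf (α : Partition n) (T : ℕ × ℕ → ℕ) (u : ℕ) : ℕ := T (u, α.parts u)

/-- The semistandard `α`-set `{T}` of `T`: those rows `u ∈ {a, …, b-1}` with `T̂(u) ≠ u`. -/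
def Tset (α : Partition n) (a b : ℕ) (T : ℕ × ℕ → ℕ) : Finset ℕ :=
  (Finset.Icc a (b - 1)).filter fun u => hatOf α T u ≠ u

/-- The removable set `{R}`: those rows `i ∈ {a, …, b-1}` such that `(i, α_i)` is a
removable node of `[α]`. -/
def Rset (α : Partition n) (a b : ℕ) : Finset ℕ :=
  (Finset.Icc a (b - 1)).filter fun i => α.parts (i + 1) < α.parts i

/-- The hook lengths `h_i` in the `(α_b + 1)`-th column of `[α]` (with `h_i = 0` for `i ≥ b`):
`h_i = α_i - α_b + b - i - 1`. -/
def hook (α : Partition n) (b i : ℕ) : ℤ :=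
  if i < b then (α.parts i : ℤ) - (α.parts b : ℤ) + (b : ℤ) - (i : ℤ) - 1 else 0

/-- `T̂⁻¹(v)`: the row `u ∈ {a, …, b-1}` with `T̂(u) = v`. -/
noncomputable def invHat (α : Partition n) (a b : ℕ) (T : ℕ × ℕ → ℕ) (v : ℕ) : ℕ :=
  sInf {u | a ≤ u ∧ u ≤ b - 1 ∧ hatOf α T u = v}

/-- The smallest element of `X` greater than `u`, or `b` if there is none. -/
noncomputable def nextIn (X : Finset ℕ) (b u : ℕ) : ℕ := sInf ({v | v ∈ X ∧ u < v} ∪ {b})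

/-- The bijection `T̂ : {a,…,b-1} → {a+1,…,b}` determined by a semistandard set `X`:
`T̂` maps each `u ∈ X` to the next element of `X ∪ {b}` above it, and fixes `u ∉ X`. -/
noncomputable def hatOfSet (X : Finset ℕ) (b u : ℕ) : ℕ :=
  if u ∈ X then nextIn X b u else u

open Classical in
/-- The (normalized) semistandard `α`-tableau of type `β` whose semistandard set is `X`:
every cell of row `i` contains `i`, except that for `a ≤ i ≤ b-1` the last cell of row `i`
contains `T̂(i)` (where `T̂` is the bijection determined by `X`). -/
noncomputable def tableauOfSet (α : Partition n) (a b : ℕ) (X : Finset ℕ) : ℕ × ℕ → ℕ :=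
  fun cc =>
    if cc ∈ α.cells then
      (if a ≤ cc.1 ∧ cc.1 ≤ b - 1 ∧ cc.2 = α.parts cc.1 then hatOfSet X b cc.1 else cc.1)
    else 0

/-- `X` is a semistandard `α`-set of type `β` (for the one-box shift from row `a` to row `b`):
`a ∈ X ⊆ {a, …, b-1}`, and `u ∈ X` together with `α_{u+1} = α_u` forces `u+1 ∈ X`. -/
def IsSSSet (α : Partition n) (a b : ℕ) (X : Finset ℕ) : Prop :=
  a ∈ X ∧ (∀ u ∈ X, a ≤ u ∧ u ≤ b - 1) ∧
    ∀ u ∈ X, α.parts (u + 1) = α.parts u → u + 1 ∈ X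

/-- The coefficient `(-1)^{|T|} ∏_{u ∈ {R}\{T}} h_u` of `θ̂_T` in the Carter-Payne
homomorphism. -/
noncomputable def cpCoeff (α : Partition n) (a b : ℕ) (T : ℕ × ℕ → ℕ) : ℤ :=
  (-1) ^ (Tset α a b T).card * ∏ u ∈ Rset α a b \ Tset α a b T, hook α b u


/-! ### Abstract part -/

lemma nextIn_spec (X : Finset ℕ) (b u : ℕ) :
    ((nextIn X b u ∈ X ∧ u < nextIn X b u) ∨ nextIn X b u = b) ∧
    (∀ v ∈ X, u < v → nextIn X b u ≤ v) ∧ nextIn X b u ≤ b := by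
  unfold nextIn
  refine ⟨?_, ?_, ?_⟩
  · have := Nat.sInf_mem (s := {v | v ∈ X ∧ u < v} ∪ {b}) ⟨b, by simp⟩
    simpa [or_comm] using this
  · intro v hv huv
    exact Nat.sInf_le (by simp [hv, huv])
  · exact Nat.sInf_le (by simp)

lemma nextIn_eq {X : Finset ℕ} {b u t : ℕ} (h1 : (t ∈ X ∧ u < t) ∨ t = b)
    (h2 : ∀ v ∈ X, u < v → t ≤ v) (h3 : t ≤ b) : nextIn X b u = t := by
  obtain ⟨k1, k2, k3⟩ := nextIn_spec X b u
  apply le_antisymm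
  · rcases h1 with h1 | h1
    · exact k2 t h1.1 h1.2
    · omega
  · rcases k1 with k1 | k1
    · exact h2 _ k1.1 k1.2
    · omega

lemma nextIn_congr {X Y : Finset ℕ} {b u : ℕ} (h : ∀ v, u < v → (v ∈ X ↔ v ∈ Y)) :
    nextIn X b u = nextIn Y b u := by
  unfold nextIn
  congr 1
  ext v
  by_cases hv : u < v
  · simp [hv, h v hv]
  · simp [hv]

lemma nextIn_congr_left {X : Finset ℕ} {b u w : ℕ} (h : ∀ v ∈ X, u < v ↔ w < v) :
    nextIn X b u = nextIn X b w := by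
  unfold nextIn
  congr 1
  ext v
  by_cases hv : v ∈ X
  · simp [hv, h v hv]
  · simp [hv]

lemma lt_nextIn {X : Finset ℕ} {b u : ℕ} (hu : u < b) : u < nextIn X b u := by
  rcases (nextIn_spec X b u).1 with h | h <;> omega

section Abstract

variable {k : Type*} [CommRing k] {M : Type*} [AddCommGroup M] [Module k M]

/-- The chain operator determined by the elements of `X` in `[j, b)`. -/
noncomputable def chainOp (E : ℕ → ℕ → Module.End k M) (b j : ℕ) (X : Finset ℕ) :
    Module.End k M :=
  (List.range' j (b - j)).foldr
    (fun u Y => if u ∈ X then E (nextIn X b u) u * Y else Y) 1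

lemma chainOp_top (E : ℕ → ℕ → Module.End k M) (b : ℕ) (X : Finset ℕ) :
    chainOp E b b X = 1 := by
  simp [chainOp]

lemma chainOp_step (E : ℕ → ℕ → Module.End k M) {b j : ℕ} (hj : j < b) (X : Finset ℕ) :
    chainOp E b j X =
      if j ∈ X then E (nextIn X b j) j * chainOp E b (j + 1) X else chainOp E b (j + 1) X := by
  unfold chainOp
  have : b - j = (b - (j + 1)) + 1 := by omega
  rw [this, List.range'_succ, List.foldr_cons]

lemma chainOp_congr (E : ℕ → ℕ → Module.End k M) {b j : ℕ} (hj : j ≤ b) {X Y : Finset ℕ}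
    (h : ∀ v, j ≤ v → (v ∈ X ↔ v ∈ Y)) : chainOp E b j X = chainOp E b j Y := by
  induction hj using Nat.decreasingInduction with
  | self => simp [chainOp_top]
  | of_succ m hk ih =>
    rw [chainOp_step E hk, chainOp_step E hk, ih (fun v hv => h v (by omega)),
      nextIn_congr (Y := Y) (fun v hv => h v (by omega))]
    simp [h m le_rfl]

/-- The defining commutation relations of `gl`. -/
def GlRel (E : ℕ → ℕ → Module.End k M) : Prop :=
  ∀ j i l m, E j i * E l m = E l m * E j i +
    ((if i = l then E j m else 0) - (if m = j then E l i else 0))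

lemma GlRel.apply {E : ℕ → ℕ → Module.End k M} (hE : GlRel E) (j i l m : ℕ) (y : M) :
    E j i (E l m y) = E l m (E j i y) +
    ((if i = l then E j m y else 0) - (if m = j then E l i y else 0)) := by
  have := congrArg (fun Z : Module.End k M => Z y) (hE j i l m)
  simp only [Module.End.mul_apply, LinearMap.add_apply, LinearMap.sub_apply] at this
  rw [this]
  split_ifs <;> simp

lemma chainOp_comm {E : ℕ → ℕ → Module.End k M} (hE : GlRel E) {b j p q : ℕ} (hj : j ≤ b)
    (hp : p < j) (hq : q < j) (X : Finset ℕ) (y : M) :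
    E p q (chainOp E b j X y) = chainOp E b j X (E p q y) := by
  induction hj using Nat.decreasingInduction with
  | self => simp [chainOp_top]
  | of_succ m hk ih =>
    rw [chainOp_step E hk]
    have ih' := ih (by omega) (by omega)
    have hl := lt_nextIn (X := X) hk
    split_ifs with h
    · simp only [Module.End.mul_apply]
      rw [hE.apply, if_neg (by omega), if_neg (by omega), ih']
      simp
    · exact ih'

variable (R : ℕ → Prop) [DecidablePred R] (h : ℕ → k)

/-- The local weight at row `u`. -/
def locWt (u : ℕ) (X : Finset ℕ) : k :=
  if u ∈ X then (if R u ∨ u + 1 ∈ X then -1 else 0) else (if R u then h u else 1)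

/-- The weight of a set. -/
def setWt (b j : ℕ) (X : Finset ℕ) : k := ∏ u ∈ Finset.Ico j b, locWt R h u X

lemma setWt_step {b j : ℕ} (hj : j < b) (X : Finset ℕ) :
    setWt R h b j X = locWt R h j X * setWt R h b (j + 1) X := by
  unfold setWt
  rw [Finset.prod_eq_prod_Ico_succ_bot hj]

lemma setWt_congr {b j : ℕ} {X Y : Finset ℕ} (hXY : ∀ v, j ≤ v → (v ∈ X ↔ v ∈ Y)) :
    setWt R h b j X = setWt R h b j Y := by
  unfold setWt
  apply Finset.prod_congr rfl
  intro u hu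
  rw [Finset.mem_Ico] at hu
  simp only [locWt, hXY u hu.1, hXY (u + 1) (by omega)]

/-- Sum over subsets of `[j,b)`, with additional first step out of row `c`. -/
noncomputable def bigD (E : ℕ → ℕ → Module.End k M) (x : M) (b j c : ℕ) : M :=
  ∑ X ∈ (Finset.Ico j b).powerset,
    setWt R h b j X • E (nextIn X b c) c (chainOp E b j X x)

/-- Sum over subsets of `[j,b)` containing `j` (for `j < b`); `x` for `j = b`. -/
noncomputable def bigG (E : ℕ → ℕ → Module.End k M) (x : M) (b j : ℕ) : M :=
  if j < b then ∑ X ∈ (Finset.Ico (j + 1) b).powerset,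
    setWt R h b j (insert j X) • chainOp E b j (insert j X) x else x

lemma mem_congr_insert {j v : ℕ} (hv : j < v) (X : Finset ℕ) : v ∈ insert j X ↔ v ∈ X := by
  simp [Finset.mem_insert]; omega

lemma bigG_term (E : ℕ → ℕ → Module.End k M) (x : M) {b j : ℕ} (hj : j < b) (X : Finset ℕ) :
    setWt R h b j (insert j X) • chainOp E b j (insert j X) x =
    locWt R h j (insert j X) • setWt R h b (j + 1) X •
      E (nextIn X b j) j (chainOp E b (j + 1) X x) := by
  rw [setWt_step R h hj, chainOp_step E hj, if_pos (Finset.mem_insert_self _ _), mul_smul,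
    setWt_congr R h (Y := X) (fun v hv => mem_congr_insert (by omega) X),
    nextIn_congr (Y := X) (fun v hv => mem_congr_insert (by omega) X),
    chainOp_congr E (by omega) (Y := X) (fun v hv => mem_congr_insert (by omega) X)]
  rfl

lemma bigG_R (E : ℕ → ℕ → Module.End k M) (x : M) {b j : ℕ} (hj : j < b) (hR : R j) :
    bigG R h E x b j = - bigD R h E x b (j + 1) j := by
  rw [bigG, if_pos hj, bigD, ← Finset.sum_neg_distrib]
  apply Finset.sum_congr rfl
  intro X hX
  rw [bigG_term R h E x hj]
  simp [locWt, hR]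

lemma bigD_top (E : ℕ → ℕ → Module.End k M) (x : M) (b c : ℕ) :
    bigD R h E x b b c = E b c x := by
  have : nextIn ∅ b c = b := nextIn_eq (by simp) (by simp) le_rfl
  simp [bigD, setWt, chainOp_top, this]

lemma sum_powerset_Ico {N : Type*} [AddCommMonoid N] {j b : ℕ} (hj : j < b)
    (F : Finset ℕ → N) :
    ∑ X ∈ (Finset.Ico j b).powerset, F X =
      ∑ X ∈ (Finset.Ico (j + 1) b).powerset, F X +
      ∑ X ∈ (Finset.Ico (j + 1) b).powerset, F (insert j X) := by
  rw [← Finset.sum_powerset_insert (by simp)]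
  congr 2
  ext v
  simp only [Finset.mem_Ico, Finset.mem_insert]
  omega

lemma bigD_step (E : ℕ → ℕ → Module.End k M) (x : M) {b j c : ℕ} (hj : j < b) (hc : c < j) :
    bigD R h E x b j c =
      (if R j then h j else 1) • bigD R h E x b (j + 1) c + E j c (bigG R h E x b j) := by
  rw [bigD, sum_powerset_Ico hj, bigG, if_pos hj, bigD, Finset.smul_sum, map_sum]
  congr 1
  · apply Finset.sum_congr rfl
    intro X hX
    rw [Finset.mem_powerset] at hX
    have hjX : j ∉ X := fun hh => by have := Finset.mem_Ico.mp (hX hh); omega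
    rw [setWt_step R h hj, chainOp_step E hj, if_neg hjX, mul_smul]
    simp [locWt, hjX]
  · apply Finset.sum_congr rfl
    intro X hX
    rw [Finset.mem_powerset] at hX
    rw [map_smul]
    have : nextIn (insert j X) b c = j := by
      apply nextIn_eq
      · left; simp [hc]
      · intro v hv _
        rcases Finset.mem_insert.mp hv with hv | hv
        · omega
        · have := Finset.mem_Ico.mp (hX hv); omega
      · omega
    rw [this]

lemma bigG_notR (E : ℕ → ℕ → Module.End k M) (x : M) {b j : ℕ} (hj : j + 1 < b) (hR : ¬ R j) :
    bigG R h E x b j = - E (j + 1) j (bigG R h E x b (j + 1)) := by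
  rw [bigG, if_pos (by omega), sum_powerset_Ico hj]
  have h0 : ∑ X ∈ (Finset.Ico (j + 1 + 1) b).powerset,
      setWt R h b j (insert j X) • chainOp E b j (insert j X) x = 0 := by
    apply Finset.sum_eq_zero
    intro X hX
    rw [Finset.mem_powerset] at hX
    rw [bigG_term R h E x (by omega)]
    have hjX : j + 1 ∉ X := fun hh => by have := Finset.mem_Ico.mp (hX hh); omega
    simp [locWt, hR, hjX]
  rw [h0, zero_add, bigG, if_pos hj, map_sum, ← Finset.sum_neg_distrib]
  apply Finset.sum_congr rfl
  intro X hX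
  rw [Finset.mem_powerset] at hX
  rw [bigG_term R h E x (by omega), map_smul]
  have : nextIn (insert (j + 1) X) b j = j + 1 := by
    apply nextIn_eq
    · left; simp
    · intro v hv _
      omega
    · omega
  rw [this]
  simp [locWt, hR]

lemma bigF {E : ℕ → ℕ → Module.End k M} (hE : GlRel E) (x : M) {b a : ℕ} (hb : R (b - 1))
    (hh : ∀ j, a < j → j < b → ¬ R j → h j = h (j + 1) + 1)
    (hx : ∀ j, a < j → j < b → ¬ R j → E (j + 1) j x = 0) (d : ℕ) :
    ∀ j, a < j → j < b → b - j = d + 1 →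
      (if R j then h j else 1) • bigD R h E x b (j + 1) j = - (h j • bigG R h E x b j) := by
  induction d with
  | zero =>
    intro j _ hjb hd
    have : j = b - 1 := by omega
    have hR : R j := this ▸ hb
    rw [if_pos hR, bigG_R R h E x hjb hR]
    simp
  | succ d ih =>
    intro j haj hjb hd
    by_cases hR : R j
    · rw [if_pos hR, bigG_R R h E x hjb hR]
      simp
    · have hj1 : j + 1 < b := by omega
      have key : bigD R h E x b (j + 1 + 1) j =
          - E (j + 1) j (bigD R h E x b (j + 1 + 1) (j + 1)) := by
        rw [bigD, bigD, map_sum, ← Finset.sum_neg_distrib]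
        apply Finset.sum_congr rfl
        intro X hX
        rw [Finset.mem_powerset] at hX
        have e1 : nextIn X b j = nextIn X b (j + 1) := by
          apply nextIn_congr_left
          intro v hv
          have := Finset.mem_Ico.mp (hX hv)
          omega
        have hl := lt_nextIn (X := X) hj1
        have hz : E (j + 1) j (chainOp E b (j + 1 + 1) X x) = 0 := by
          rw [chainOp_comm hE (by omega) (by omega) (by omega), hx j haj hjb hR, map_zero]
        rw [map_smul, hE.apply, if_neg (by omega), if_pos rfl, hz, e1]
        simp
      rw [if_neg hR, one_smul, bigD_step R h E x hj1 (by omega), key, bigG_notR R h E x hj1 hR,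
        smul_neg, ← map_smul, ih (j + 1) (by omega) hj1 (by omega), hh j haj hjb hR]
      simp only [map_neg, map_smul, neg_neg, smul_neg]
      module

lemma bigMain {E : ℕ → ℕ → Module.End k M} (hE : GlRel E) (x : M) {b a : ℕ} (hab : a < b)
    (ha : R a) (hb : R (b - 1)) (p q : k)
    (hh : ∀ j, a < j → j < b → ¬ R j → h j = h (j + 1) + 1)
    (hx : ∀ j, a < j → j < b → ¬ R j → E (j + 1) j x = 0)
    (hx0 : E a (a + 1) x = 0) (hxa : E a a x = p • x) (hxb : E (a + 1) (a + 1) x = q • x)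
    (h1 : a + 1 < b → h a = h (a + 1) + p - q + 1) (h2 : b = a + 1 → h a = p - q) :
    E a (a + 1) (bigG R h E x b a) = h a • (- bigG R h E x b (a + 1)) := by
  rw [bigG_R R h E x hab ha]
  rcases Nat.lt_or_ge (a + 1) b with hlt | hge
  · have hF := bigF R h hE x hb hh hx (b - (a + 1) - 1) (a + 1) (by omega) hlt (by omega)
    rw [bigD_step R h E x hlt (by omega)]
    have key : E a (a + 1) (bigD R h E x b (a + 1 + 1) a) =
        - bigD R h E x b (a + 1 + 1) (a + 1) := by
      rw [bigD, bigD, map_sum, ← Finset.sum_neg_distrib]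
      apply Finset.sum_congr rfl
      intro X hX
      rw [Finset.mem_powerset] at hX
      have e1 : nextIn X b a = nextIn X b (a + 1) := by
        apply nextIn_congr_left
        intro v hv
        have := Finset.mem_Ico.mp (hX hv)
        omega
      have hl := lt_nextIn (X := X) hlt
      have hz : E a (a + 1) (chainOp E b (a + 1 + 1) X x) = 0 := by
        rw [chainOp_comm hE (by omega) (by omega) (by omega), hx0, map_zero]
      rw [map_smul, hE.apply, if_neg (by omega), if_pos rfl, hz, e1]
      simp
    have hG : ∀ X ⊆ Finset.Ico (a + 1 + 1) b,
        E a (a + 1) (chainOp E b (a + 1) (insert (a + 1) X) x) = 0 ∧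
        E a a (chainOp E b (a + 1) (insert (a + 1) X) x) =
          p • (chainOp E b (a + 1) (insert (a + 1) X) x) ∧
        E (a + 1) (a + 1) (chainOp E b (a + 1) (insert (a + 1) X) x) =
          (q - 1) • (chainOp E b (a + 1) (insert (a + 1) X) x) := by
      intro X hX
      have hl := lt_nextIn (X := insert (a + 1) X) hlt
      rw [chainOp_step E hlt, if_pos (Finset.mem_insert_self _ _)]
      simp only [Module.End.mul_apply]
      refine ⟨?_, ?_, ?_⟩
      · rw [hE.apply, if_neg (by omega), if_neg (by omega),
          chainOp_comm hE (by omega) (by omega) (by omega), hx0]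
        simp
      · rw [hE.apply, if_neg (by omega), if_neg (by omega),
          chainOp_comm hE (by omega) (by omega) (by omega), hxa]
        simp
      · rw [hE.apply, if_neg (by omega), if_pos rfl,
          chainOp_comm hE (by omega) (by omega) (by omega), hxb]
        simp only [map_smul]
        module
    have g0 : E a (a + 1) (bigG R h E x b (a + 1)) = 0 := by
      rw [bigG, if_pos hlt, map_sum]
      refine Finset.sum_eq_zero fun X hX => ?_
      rw [map_smul, (hG X (Finset.mem_powerset.mp hX)).1, smul_zero]
    have g1 : E a a (bigG R h E x b (a + 1)) = p • bigG R h E x b (a + 1) := by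
      rw [bigG, if_pos hlt, map_sum, Finset.smul_sum]
      refine Finset.sum_congr rfl fun X hX => ?_
      rw [map_smul, (hG X (Finset.mem_powerset.mp hX)).2.1, smul_comm]
    have g2 : E (a + 1) (a + 1) (bigG R h E x b (a + 1)) =
        (q - 1) • bigG R h E x b (a + 1) := by
      rw [bigG, if_pos hlt, map_sum, Finset.smul_sum]
      refine Finset.sum_congr rfl fun X hX => ?_
      rw [map_smul, (hG X (Finset.mem_powerset.mp hX)).2.2, smul_comm]
    rw [map_neg, map_add, map_smul, key, hE.apply, g0, if_pos rfl, if_pos rfl, g1, g2, smul_neg,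
      hF, h1 hlt]
    simp only [map_zero]
    module
  · obtain rfl : b = a + 1 := by omega
    rw [bigD_top, bigG, if_neg (by omega), map_neg, hE.apply, hx0, if_pos rfl, if_pos rfl, hxa,
      hxb, h2 rfl]
    simp only [map_zero]
    module

end Abstract

/-! ### Concrete operators on functions on words -/

/-- Functions on words. -/
abbrev Wd (n : ℕ) := (Fin n → ℕ) → ℤ

/-- The operator at the site `s`. -/
noncomputable def siteOp (s : Fin n) (j i : ℕ) : Module.End ℤ (Wd n) where
  toFun φ := fun g => if g s = j then φ (Function.update g s i) else 0
  map_add' φ χ := by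
    funext g
    by_cases hg : g s = j <;> simp [hg]
  map_smul' r φ := by
    funext g
    by_cases hg : g s = j <;> simp [hg]

/-- The total operator: move one symbol from row `i` to row `j`. -/
noncomputable def rowOp (n : ℕ) (j i : ℕ) : Module.End ℤ (Wd n) := ∑ s : Fin n, siteOp s j i

lemma siteOp_apply (s : Fin n) (j i : ℕ) (φ : Wd n) (g : Fin n → ℕ) :
    siteOp s j i φ g = if g s = j then φ (Function.update g s i) else 0 := rfl

lemma rowOp_apply (j i : ℕ) (φ : Wd n) (g : Fin n → ℕ) :
    rowOp n j i φ g = ∑ s, if g s = j then φ (Function.update g s i) else 0 := by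
  simp [rowOp, LinearMap.sum_apply, Finset.sum_apply, siteOp_apply]

lemma siteOp_mul_self (s : Fin n) (j i l m : ℕ) :
    siteOp s j i * siteOp s l m = if i = l then siteOp s j m else 0 := by
  ext φ g
  by_cases hil : i = l <;> by_cases hg : g s = j <;>
    simp [hil, hg, siteOp_apply]

lemma siteOp_mul_comm {s s' : Fin n} (hs : s ≠ s') (j i l m : ℕ) :
    siteOp s j i * siteOp s' l m = siteOp s' l m * siteOp s j i := by
  ext φ g
  simp only [Module.End.mul_apply, siteOp_apply, Function.update_of_ne hs,
    Function.update_of_ne hs.symm, Function.update_comm hs]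
  split_ifs <;> rfl

lemma rowOp_glRel (n : ℕ) : GlRel (rowOp n) := by
  intro j i l m
  have h1 : ∀ j i l m, rowOp n j i * rowOp n l m = ∑ s : Fin n, ∑ s' : Fin n,
      siteOp s j i * siteOp s' l m := by
    intro j i l m
    simp only [rowOp, Finset.sum_mul, Finset.mul_sum]
    try rw [Finset.sum_comm]
  rw [h1, h1 l m j i, Finset.sum_comm (f := fun s s' => siteOp s l m * siteOp s' j i),
    ← sub_eq_iff_eq_add', ← Finset.sum_sub_distrib]
  have h2 : ∀ s : Fin n, (∑ s' : Fin n, siteOp s j i * siteOp s' l m) -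
      (∑ s' : Fin n, siteOp s' l m * siteOp s j i) =
      (if i = l then siteOp s j m else 0) - (if m = j then siteOp s l i else 0) := by
    intro s
    rw [← Finset.sum_sub_distrib, Finset.sum_eq_single s]
    · rw [siteOp_mul_self, siteOp_mul_self]
    · intro s' _ hs'
      rw [siteOp_mul_comm hs'.symm, sub_self]
    · simp
  rw [Finset.sum_congr rfl (fun s _ => h2 s), Finset.sum_sub_distrib]
  congr 1 <;> split_ifs <;> simp [rowOp]

/-- Embedding of the permutation module. -/
noncomputable def emb (c : ℕ → ℕ) : PermMod ℤ n c →ₗ[ℤ] Wd n :=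
  Finsupp.linearCombination ℤ (fun f : Tabloid n c => (Pi.single f.1 1 : Wd n))

lemma emb_single (c : ℕ → ℕ) (f : Tabloid n c) :
    emb c (Finsupp.single f 1) = Pi.single f.1 1 := by
  simp [emb]

lemma emb_apply (c : ℕ → ℕ) (x : PermMod ℤ n c) (g : Tabloid n c) : emb c x g.1 = x g := by
  classical
  induction x using Finsupp.induction_linear with
  | zero => simp
  | add x y hx hy => simp [hx, hy]
  | single f r =>
    simp only [emb, Finsupp.linearCombination_single, Pi.smul_apply, Finsupp.single_apply,
      Pi.single_apply, smul_eq_mul, mul_ite, mul_one, mul_zero]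
    refine if_congr ⟨fun h => h ▸ rfl, fun h => Subtype.ext h.symm⟩ rfl rfl |>.symm

lemma rowOp_weight (c : ℕ → ℕ) (i : ℕ) (x : PermMod ℤ n c) :
    rowOp n i i (emb c x) = (c i : ℤ) • emb c x := by
  induction x using Finsupp.induction_linear with
  | zero => simp
  | add x y hx hy => simp [hx, hy]
  | single f r =>
    have : (Finsupp.single f r : PermMod ℤ n c) = r • Finsupp.single f 1 := by simp
    rw [this, map_smul, map_smul, smul_comm, emb_single]
    congr 1
    funext g
    rw [rowOp_apply]
    have h1 : ∀ s : Fin n, (if g s = i then (Pi.single f.1 1 : Wd n) (Function.update g s i)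
        else 0) = if g s = i then (Pi.single f.1 1 : Wd n) g else 0 := by
      intro s
      split_ifs with h
      · rw [← h, Function.update_eq_self]
      · rfl
    rw [Finset.sum_congr rfl (fun s _ => h1 s), ← Finset.sum_filter, Finset.sum_const]
    by_cases hg : g = f.1
    · subst hg
      rw [f.2 i]
      simp
    · simp [Pi.single_apply, hg]

lemma emb_polytabloid {μ : Partition n} (t : Placement μ) (g : Fin n → ℕ) :
    emb μ.parts (polytabloid ℤ t) g =
      ∑ π ∈ colStab t, if (∀ k, (t.pos (π k)).1 = g k) then (Equiv.Perm.sign π : ℤ) else 0 := by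
  classical
  simp only [polytabloid, map_sum, map_smul, emb_single, Finset.sum_apply, Pi.smul_apply,
    Pi.single_apply]
  apply Finset.sum_congr rfl
  intro π _
  have : (g = (rowTabloid t π).1) ↔ ∀ k, (t.pos (π k)).1 = g k := by
    constructor
    · intro h k; rw [h]; rfl
    · intro h; funext k; exact (h k).symm
  simp [this]

lemma rowOp_polytabloid {μ : Partition n} (t : Placement μ) {p q : ℕ} (hpq : p ≠ q)
    (hp : 0 < p) (hq : 0 < q)
    (hμ : μ.parts p ≤ μ.parts q) : rowOp n q p (emb μ.parts (polytabloid ℤ t)) = 0 := by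
  classical
  funext g
  rw [rowOp_apply]
  simp only [emb_polytabloid, Pi.zero_apply]
  simp only [← Finset.sum_filter]
  rw [← Finset.sum_finset_product' 
    (r := (Finset.univ ×ˢ Finset.univ).filter fun z : Fin n × Equiv.Perm (Fin n) =>
      g z.1 = q ∧ z.2 ∈ colStab t ∧ ∀ k, (t.pos (z.2 k)).1 = Function.update g z.1 p k)
    (s := Finset.univ.filter fun s => g s = q)
    (t := fun s => (colStab t).filter fun π => ∀ k, (t.pos (π k)).1 = Function.update g s p k)
    (f := fun _ π => (Equiv.Perm.sign π : ℤ))]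
  swap
  · intro z; simp
  have hpos : ∀ z : Fin n × Equiv.Perm (Fin n), ∃ k : Fin n,
      (t.pos (z.2 z.1)).1 = p → t.pos (z.2 k) = (q, (t.pos (z.2 z.1)).2) := by
    intro z
    by_cases hz : (t.pos (z.2 z.1)).1 = p
    · obtain ⟨h1, h2, h3⟩ := t.mem (z.2 z.1)
      obtain ⟨k, hk⟩ := t.surj (q, (t.pos (z.2 z.1)).2) ⟨hq, h2, by
        rw [hz] at h3; exact h3.trans hμ⟩
      exact ⟨z.2.symm k, by simp [hk]⟩
    · exact ⟨z.1, fun h => absurd h hz⟩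
  choose K hK using hpos
  have hz1 : ∀ z : Fin n × Equiv.Perm (Fin n),
      (∀ k, (t.pos (z.2 k)).1 = Function.update g z.1 p k) → (t.pos (z.2 z.1)).1 = p := by
    intro z h; simpa using h z.1
  have hne : ∀ z : Fin n × Equiv.Perm (Fin n), (t.pos (z.2 z.1)).1 = p → K z ≠ z.1 := by
    intro z h h'
    have := hK z h
    rw [h'] at this
    rw [this] at h
    exact hpq h.symm
  refine Finset.sum_involution (fun z _ => (K z, z.2 * Equiv.swap z.1 (K z))) ?_ ?_ ?_ ?_
  · intro z hz
    simp only [Finset.mem_filter, Finset.mem_product, Finset.mem_univ, true_and] at hz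
    have hn := hne z (hz1 z hz.2.2)
    rw [Equiv.Perm.sign_mul, Equiv.Perm.sign_swap hn.symm]
    simp
  · intro z hz _
    simp only [Finset.mem_filter, Finset.mem_product, Finset.mem_univ, true_and] at hz
    have hn := hne z (hz1 z hz.2.2)
    intro h
    exact hn (congrArg Prod.fst h)
  · intro z hz
    simp only [Finset.mem_filter, Finset.mem_product, Finset.mem_univ, true_and] at hz ⊢
    have hp1 := hz1 z hz.2.2
    have hn := hne z hp1
    have hk := hK z hp1
    obtain ⟨hg, hc, hr⟩ := hz
    simp only [colStab, Finset.mem_filter, Finset.mem_univ, true_and] at hc ⊢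
    refine ⟨?_, ?_, ?_⟩
    · have := hr (K z)
      rw [Function.update_of_ne hn, hk] at this
      exact this.symm
    · intro k
      rw [Equiv.Perm.mul_apply, Equiv.swap_apply_def]
      split_ifs with h1 h2
      · rw [hk, h1]; exact hc z.1
      · rw [h2, ← hc (K z), hk]
      · exact hc k
    · intro k
      rw [Equiv.Perm.mul_apply, Equiv.swap_apply_def, Function.update_apply]
      split_ifs with h1 h2 h3 h3 
      · exact absurd (h2.symm.trans h1) hn
      · rw [hk, h1, hg]
      · exact hp1
      · rw [hr k, Function.update_of_ne h1]
  · intro z hz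
    simp only [Finset.mem_filter, Finset.mem_product, Finset.mem_univ, true_and] at hz
    have hp1 := hz1 z hz.2.2
    have hk := hK z hp1
    have hn := hne z hp1
    have h2 := hK (K z, z.2 * Equiv.swap z.1 (K z)) (by simpa using hp1)
    have h3 : K (K z, z.2 * Equiv.swap z.1 (K z)) = z.1 := by
      simp only [Equiv.Perm.mul_apply, Equiv.swap_apply_right] at h2
      rw [← hk] at h2
      have h4 := z.2.injective (t.inj h2)
      have h5 : Equiv.swap z.1 (K z) (K (K z, z.2 * Equiv.swap z.1 (K z))) =
        Equiv.swap z.1 (K z) z.1 := by rw [h4, Equiv.swap_apply_left]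
      exact (Equiv.swap z.1 (K z)).injective h5
    ext1
    · exact h3
    · simp only [h3]
      rw [mul_assoc, Equiv.swap_comm (K z) z.1, Equiv.swap_mul_self, mul_one]

lemma rowOp_specht {μ : Partition n} {p q : ℕ} (hpq : p ≠ q) (hp : 0 < p) (hq : 0 < q)
    (hμ : μ.parts p ≤ μ.parts q) (x : ↥(Specht ℤ μ)) : rowOp n q p (emb μ.parts x.1) = 0 := by
  have : Specht ℤ μ ≤ LinearMap.ker (rowOp n q p ∘ₗ emb μ.parts) := by
    rw [Specht, Submodule.span_le]
    rintro _ ⟨t, rfl⟩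
    exact rowOp_polytabloid t hpq hp hq hμ
  exact this x.2

lemma psi_emb (c : ℕ → ℕ) (a : ℕ) (hc : 0 < c (a + 1)) (x : PermMod ℤ n c)
    (g : Tabloid n (nuComp c a (c (a + 1) - 1))) :
    psi ℤ c a (c (a + 1) - 1) x g = rowOp n a (a + 1) (emb c x) g.1 := by
  classical
  induction x using Finsupp.induction_linear with
  | zero => simp
  | add x y hx hy => simp [hx, hy]
  | single f r =>
    have : (Finsupp.single f r : PermMod ℤ n c) = r • Finsupp.single f 1 := by simp
    rw [this, map_smul, map_smul, map_smul, emb_single, Finsupp.smul_apply, Pi.smul_apply]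
    congr 1
    rw [rowOp_apply]
    simp only [psi, Finsupp.lift_apply, Finsupp.sum_single_index, one_smul, zero_smul]
    rw [Finsupp.finsetSum_apply]
    simp only [Finsupp.single_apply, Finset.sum_ite_eq', Finset.mem_filter, Finset.mem_univ,
      true_and, Pi.single_apply]
    simp only [← ite_and]
    by_cases hrel : ∀ k, g.1 k = f.1 k ∨ (f.1 k = a + 1 ∧ g.1 k = a)
    · rw [if_pos hrel]
      have hsub : (Finset.univ.filter fun k => g.1 k = a + 1) ⊆
          (Finset.univ.filter fun k => f.1 k = a + 1) := by
        intro k hk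
        simp only [Finset.mem_filter, Finset.mem_univ, true_and] at hk ⊢
        rcases hrel k with h | h <;> omega
      have hcard := Finset.card_sdiff_add_card_eq_card hsub
      rw [f.2, g.2] at hcard
      simp only [nuComp, if_true, Nat.succ_ne_self, if_false] at hcard
      have h1 : ((Finset.univ.filter fun k => f.1 k = a + 1) \
        (Finset.univ.filter fun k => g.1 k = a + 1)).card = 1 := by
        have : ¬ (a + 1 = a) := by omega
        omega
      obtain ⟨k0, hk0⟩ := Finset.card_eq_one.mp h1
      have hk0' : ∀ k, (f.1 k = a + 1 ∧ g.1 k ≠ a + 1) ↔ k = k0 := by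
        intro k
        have := Finset.ext_iff.mp hk0 k
        simpa using this
      rw [Finset.sum_eq_single k0]
      · have h2 := (hk0' k0).2 rfl
        rw [if_pos]
        refine ⟨?_, ?_⟩
        · rcases hrel k0 with h | h <;> omega
        · funext k
          rw [Function.update_apply]
          split_ifs with hk
          · rw [hk, h2.1]
          · rcases hrel k with h | h
            · exact h
            · exact absurd ((hk0' k).1 ⟨h.1, by omega⟩) hk
      · intro k _ hk
        rw [if_neg]
        rintro ⟨h3, h4⟩
        apply hk
        rw [← hk0' k, ← h4]
        simp [h3]
      · simp
    · rw [if_neg hrel, Finset.sum_eq_zero]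
      intro k _
      rw [if_neg]
      rintro ⟨h3, h4⟩
      apply hrel
      intro k'
      rw [← h4, Function.update_apply]
      split_ifs with h
      · right; exact ⟨rfl, h ▸ h3⟩
      · left; rfl

/-! ### The chain operators compute James' homomorphisms -/

/-- Number of symbols in row `i` of `f` and row `j` of `g`. -/
def cnt (f g : Fin n → ℕ) (i j : ℕ) : ℕ := (Finset.univ.filter fun k => f k = i ∧ g k = j).card

lemma cnt_update (f g : Fin n → ℕ) (s : Fin n) (p i j : ℕ) (hp : f s = p) (hg : g s ≠ p)
    (hij : i ≠ j) :
    cnt f g i j = cnt f (Function.update g s p) i j + if i = p ∧ g s = j then 1 else 0 := by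
  classical
  unfold cnt
  split_ifs with h
  · have : (Finset.univ.filter fun k => f k = i ∧ g k = j) =
        insert s (Finset.univ.filter fun k => f k = i ∧ Function.update g s p k = j) := by
      ext k
      simp only [Finset.mem_filter, Finset.mem_univ, true_and, Finset.mem_insert,
        Function.update_apply]
      by_cases hk : k = s
      · subst hk; simp [hp, h.1, h.2]
      · simp [hk]
    rw [this, Finset.card_insert_of_notMem]
    simp only [Finset.mem_filter, Finset.mem_univ, true_and, Function.update_self, not_and]
    intro _ h3
    exact hij (h.1.trans h3)
  · rw [add_zero]
    congr 1
    ext k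
    simp only [Finset.mem_filter, Finset.mem_univ, true_and, Function.update_apply]
    by_cases hk : k = s
    · subst hk
      simp only [if_true]
      constructor
      · rintro ⟨h1, h2⟩; exact absurd ⟨h1.symm.trans hp, h2⟩ h
      · rintro ⟨h1, h2⟩; exact absurd (h1.symm.trans (hp.trans h2)) hij
    · simp [hk]

open Classical in
lemma chainOp_single (f : Fin n → ℕ) (X : Finset ℕ) {b j : ℕ} (hj : j ≤ b) :
    ∀ g : Fin n → ℕ, chainOp (rowOp n) b j X (Pi.single f 1) g =
      if (∀ i m, i ≠ m → cnt f g i m =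
        if (j ≤ i ∧ i < b ∧ i ∈ X ∧ nextIn X b i = m) then 1 else 0) then 1 else 0 := by
  induction hj using Nat.decreasingInduction with
  | self =>
    intro g
    rw [chainOp_top, Module.End.one_apply, Pi.single_apply]
    refine if_congr ?_ rfl rfl
    constructor
    · rintro rfl i m him
      rw [if_neg (by omega), cnt, Finset.card_eq_zero, Finset.filter_eq_empty_iff]
      rintro k - ⟨h1, h2⟩
      exact him (h1.symm.trans h2)
    · intro h
      funext k
      by_contra hk
      have := h (f k) (g k) (fun h => hk h.symm)
      rw [if_neg (by omega), cnt, Finset.card_eq_zero, Finset.filter_eq_empty_iff] at this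
      exact this (Finset.mem_univ k) ⟨rfl, rfl⟩
  | of_succ p hp ih =>
    intro g
    rw [chainOp_step _ hp]
    by_cases hpX : p ∈ X
    swap
    · rw [if_neg hpX, ih g]
      refine if_congr ?_ rfl rfl
      refine forall_congr' fun i => forall_congr' fun m => imp_congr_right fun _ => ?_
      have hh : (p + 1 ≤ i ∧ i < b ∧ i ∈ X ∧ nextIn X b i = m) ↔
          (p ≤ i ∧ i < b ∧ i ∈ X ∧ nextIn X b i = m) := by
        by_cases hi : i = p
        · subst hi; simp [hpX]
        · have : p + 1 ≤ i ↔ p ≤ i := by omega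
          rw [this]
      simp only [hh]
    · rw [if_pos hpX, Module.End.mul_apply, rowOp_apply]
      have hl := lt_nextIn (X := X) hp
      set t := nextIn X b p with ht
      -- each summand
      have hterm : ∀ s : Fin n, (if g s = t then
          chainOp (rowOp n) b (p + 1) X (Pi.single f 1) (Function.update g s p) else 0) =
          if (f s = p ∧ g s = t) ∧ (∀ i m, i ≠ m → cnt f g i m =
            if (p ≤ i ∧ i < b ∧ i ∈ X ∧ nextIn X b i = m) then 1 else 0) then (1 : ℤ) else 0 := by
        intro s
        by_cases hgs : g s = t
        swap
        · simp [hgs]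
        rw [if_pos hgs, ih]
        refine if_congr ?_ rfl rfl
        by_cases hfs : f s = p
        · simp only [hfs, hgs, true_and]
          refine forall_congr' fun i => forall_congr' fun m => forall_congr' fun him => ?_
          rw [cnt_update f g s p i m hfs (by omega) him, hgs]
          by_cases hi : i = p
          · subst hi
            have h1 : ¬ (i + 1 ≤ i) := by omega
            by_cases hm : t = m
            · subst hm; simp [h1, hp, hpX, ← ht]
            · simp [h1, hm, ← ht]
          · have : p + 1 ≤ i ↔ p ≤ i := by omega
            simp [hi, this]
        · simp only [hfs, false_and, iff_false]
          intro h
          have h1 := h (f s) p hfs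
          rw [if_neg, cnt, Finset.card_eq_zero, Finset.filter_eq_empty_iff] at h1
          · exact h1 (Finset.mem_univ s) (by simp)
          · rintro ⟨h3, h4, -, h5⟩
            have := lt_nextIn (X := X) h4
            omega
      rw [Finset.sum_congr rfl (fun s _ => hterm s)]
      by_cases hall : (∀ i m, i ≠ m → cnt f g i m =
            if (p ≤ i ∧ i < b ∧ i ∈ X ∧ nextIn X b i = m) then 1 else 0)
      · rw [if_pos hall]
        have h1 := hall p t (by omega)
        rw [if_pos ⟨le_rfl, hp, hpX, rfl⟩, cnt] at h1
        simp only [and_iff_left hall]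
        rw [← Finset.sum_filter, Finset.sum_const, h1]
        simp
      · simp [hall]

lemma mem_cellFinset {α : Partition n} {c : ℕ × ℕ} : c ∈ cellFinset α ↔ c ∈ α.cells := by
  simp [cellFinset]

lemma cells_row_pos {α : Partition n} {i c : ℕ} (h1 : 0 < c) (h2 : c ≤ α.parts i) :
    (i, c) ∈ α.cells := by
  refine ⟨?_, h1, h2⟩
  rcases Nat.eq_zero_or_pos i with h | h
  · subst h; rw [α.parts_zero] at h2; omega
  · exact h

/-- Row counts agree as soon as the off-diagonal ones do. -/
lemma card_diag_aux {A B : Type*} (s : Finset A) (u : Finset B) (F : A → ℕ) (G : B → ℕ)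
    (hst : s.card = u.card) (i : ℕ)
    (h : ∀ m, i ≠ m → (s.filter fun x => F x = m).card = (u.filter fun x => G x = m).card) :
    (s.filter fun x => F x = i).card = (u.filter fun x => G x = i).card := by
  classical
  have key : (s.filter fun x => F x ≠ i).card = (u.filter fun x => G x ≠ i).card := by
    rw [Finset.card_eq_sum_card_fiberwise (f := F)
      (t := (s.image F ∪ u.image G).filter fun m => i ≠ m),
      Finset.card_eq_sum_card_fiberwise (f := G)
      (t := (s.image F ∪ u.image G).filter fun m => i ≠ m)]
    · apply Finset.sum_congr rfl
      intro m hm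
      have him := (Finset.mem_filter.mp hm).2
      rw [Finset.filter_filter, Finset.filter_filter]
      convert h m him using 2 <;>
      · ext x
        simp only [Finset.mem_filter]
        constructor
        · rintro ⟨h1, -, h2⟩; exact ⟨h1, h2⟩
        · rintro ⟨h1, h2⟩; exact ⟨h1, by rw [h2]; exact him.symm, h2⟩
    · intro x hx
      simp only [Finset.coe_filter, Set.mem_ofPred_eq, Finset.mem_union, Finset.mem_image] at hx ⊢
      exact ⟨Or.inr ⟨x, hx.1, rfl⟩, fun h => hx.2 h.symm⟩
    · intro x hx
      simp only [Finset.coe_filter, Set.mem_ofPred_eq, Finset.mem_union, Finset.mem_image] at hx ⊢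
      exact ⟨Or.inl ⟨x, hx.1, rfl⟩, fun h => hx.2 h.symm⟩
  have h1 := Finset.card_filter_add_card_filter_not (s := s) (fun x => F x = i)
  have h2 := Finset.card_filter_add_card_filter_not (s := u) (fun x => G x = i)
  simp only [ne_eq] at key
  omega

lemma rowContent_eq (α : Partition n) (T : ℕ × ℕ → ℕ) (i j : ℕ) :
    ((cellFinset α).filter fun c => c.1 = i ∧ T c = j).card = rowContent α T i j := by
  classical
  unfold rowContent
  symm
  apply Finset.card_bij (fun col _ => (i, col))
  · intro c hc
    simp only [Finset.mem_filter, Finset.mem_Icc, mem_cellFinset] at hc ⊢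
    exact ⟨cells_row_pos hc.1.1 hc.1.2, trivial, hc.2⟩
  · intro c _ c' _ h
    exact (Prod.ext_iff.mp h).2
  · rintro ⟨i', c⟩ hc
    simp only [Finset.mem_filter, mem_cellFinset] at hc
    obtain ⟨⟨h1, h2, h3⟩, h4, h5⟩ := hc
    simp only at h1 h2 h3 h4
    subst h4
    exact ⟨c, by simp [h5]; omega, rfl⟩

lemma type_of_cnt (α : Partition n) (T : ℕ × ℕ → ℕ) (c : ℕ → ℕ) (hT : IsTypeOf α c T)
    (f g : Fin n → ℕ) (h : ∀ i j, cnt f g i j = rowContent α T i j) (j : ℕ) :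
    (Finset.univ.filter fun k => g k = j).card = c j := by
  classical
  rw [← hT j, Finset.card_eq_sum_card_fiberwise (f := f)
      (t := Finset.univ.image f ∪ (cellFinset α).image Prod.fst),
      Finset.card_eq_sum_card_fiberwise (s := (cellFinset α).filter _) (f := Prod.fst)
      (t := Finset.univ.image f ∪ (cellFinset α).image Prod.fst)]
  · apply Finset.sum_congr rfl
    intro i _
    rw [Finset.filter_filter, Finset.filter_filter]
    have h1 := h i j
    rw [← rowContent_eq, cnt] at h1
    simpa only [and_comm] using h1
  · intro x hx
    simp only [Finset.coe_filter, Set.mem_ofPred_eq, Finset.coe_union, Set.mem_union,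
      Finset.coe_image, Set.mem_image, Finset.mem_coe] at hx ⊢
    exact Or.inr ⟨x, hx.1, rfl⟩
  · intro x hx
    simp

open Classical in
lemma emb_theta_single (α : Partition n) (c : ℕ → ℕ) (T : ℕ × ℕ → ℕ) (hT : IsTypeOf α c T)
    (f : Tabloid n α.parts) (g : Fin n → ℕ) :
    emb c (theta ℤ α c T (Finsupp.single f 1)) g =
      if (∀ i j, i ≠ j → cnt f.1 g i j = rowContent α T i j) then 1 else 0 := by
  have hiff : (∀ i j, i ≠ j → cnt f.1 g i j = rowContent α T i j) ↔
      ∀ i j, cnt f.1 g i j = rowContent α T i j := by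
    constructor
    · intro h i j
      by_cases hij : i = j
      · subst hij
        unfold cnt rowContent
        rw [← Finset.filter_filter]
        apply card_diag_aux
        · rw [f.2 i]; simp
        · intro m him
          rw [Finset.filter_filter]
          exact h i m him
      · exact h i j hij
    · intro h i j _; exact h i j
  simp only [theta, Finsupp.lift_apply, Finsupp.sum_single_index, one_smul, zero_smul]
  rw [map_sum]
  simp only [emb_single, Finset.sum_apply, Pi.single_apply]
  by_cases h : ∀ i j, i ≠ j → cnt f.1 g i j = rowContent α T i j
  · rw [if_pos h]
    rw [hiff] at h
    let g' : Tabloid n c := ⟨g, type_of_cnt α T c hT f.1 g h⟩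
    rw [Finset.sum_eq_single g']
    · simp [g']
    · intro g'' _ hne
      rw [if_neg]
      intro h'
      exact hne (Subtype.ext h'.symm)
    · intro h'
      exact absurd (Finset.mem_filter.mpr ⟨Finset.mem_univ _, h⟩) h'
  · rw [if_neg h]
    apply Finset.sum_eq_zero
    intro g' hg'
    rw [if_neg]
    rintro rfl
    exact h (hiff.mpr (Finset.mem_filter.mp hg').2)

lemma emb_theta_eq (α : Partition n) (c : ℕ → ℕ) (T : ℕ × ℕ → ℕ) (hT : IsTypeOf α c T)
    (X : Finset ℕ) {a b : ℕ} (hab : a ≤ b)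
    (hTX : ∀ i m, i ≠ m → rowContent α T i m =
        if (a ≤ i ∧ i < b ∧ i ∈ X ∧ nextIn X b i = m) then 1 else 0)
    (x : PermMod ℤ n α.parts) :
    emb c (theta ℤ α c T x) = chainOp (rowOp n) b a X (emb α.parts x) := by
  classical
  induction x using Finsupp.induction_linear with
  | zero => simp
  | add x y hx hy => simp [hx, hy]
  | single f r =>
    have : (Finsupp.single f r : PermMod ℤ n α.parts) = r • Finsupp.single f 1 := by simp
    rw [this, map_smul, map_smul, map_smul, map_smul, emb_single]
    congr 1
    funext g
    rw [emb_theta_single α c T hT f g, chainOp_single f.1 X hab g]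
    refine if_congr ?_ rfl rfl
    refine forall_congr' fun i => forall_congr' fun m => forall_congr' fun him => ?_
    rw [hTX i m him]

/-! ### Semistandard tableaux of type `β` -/

section SST

variable {α β : Partition n} {a b : ℕ}

lemma parts_pos (hs : OneBoxShift α β a b) {i : ℕ} (hi : 0 < i) (hib : i < b) :
    0 < α.parts i := by
  have h1 := hs.add
  have h2 := α.antitone hi (show i ≤ b - 1 by omega)
  omega

lemma tab_apply {X : Finset ℕ} (hX : IsSSSet α a b X) {i c : ℕ} (h : (i, c) ∈ α.cells) :
    tableauOfSet α a b X (i, c) = if i ∈ X ∧ c = α.parts i then nextIn X b i else i := by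
  unfold tableauOfSet hatOfSet
  rw [if_pos h]
  simp only
  by_cases hi : i ∈ X
  · have := hX.2.1 i hi
    simp [hi, this.1, this.2]
  · simp [hi]

lemma tab_le {X : Finset ℕ} (hs : OneBoxShift α β a b) (hX : IsSSSet α a b X) {i c : ℕ}
    (h : (i, c) ∈ α.cells) :
    i ≤ tableauOfSet α a b X (i, c) := by
  rw [tab_apply hX h]
  split_ifs with h1
  · have := hX.2.1 i h1.1
    have := hs.a_lt_b
    exact (lt_nextIn (by omega)).le
  · exact le_rfl

lemma tab_semistandard {X : Finset ℕ} (hs : OneBoxShift α β a b) (hX : IsSSSet α a b X) :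
    IsSemistandard α (tableauOfSet α a b X) := by
  have hab := hs.a_lt_b
  constructor
  · intro i j j' hj hj' hle
    by_cases h : j = α.parts i
    · have : j' ≤ α.parts i := hj'.2.2
      have : j' = j := by omega
      rw [this]
    · rw [tab_apply hX hj, if_neg (by tauto)]
      exact tab_le hs hX hj'
  · intro i i' j hj hj' hlt
    have h1 := tab_le hs hX hj'
    rw [tab_apply hX hj]
    split_ifs with h
    · obtain ⟨hi, rfl⟩ := h
      have hb := hX.2.1 i hi
      have hi0 : 0 < i := hj.1
      have h2 : α.parts i ≤ α.parts i' := hj'.2.2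
      have h3 := α.antitone (show 0 < i + 1 by omega) (show i + 1 ≤ i' by omega)
      have h4 := α.antitone hi0 (show i ≤ i + 1 by omega)
      have h5 := hX.2.2 i hi (by omega)
      have hb' := hX.2.1 _ h5
      have h6 : nextIn X b i = i + 1 :=
        nextIn_eq (Or.inl ⟨h5, by omega⟩) (fun v _ hv => by omega) (by omega)
      rw [h6]
      by_cases h7 : i' = i + 1
      · subst h7
        rw [tab_apply hX hj', if_pos ⟨h5, by omega⟩]
        exact lt_nextIn (by omega)
      · omega
    · omega

lemma rowContent_tab {X : Finset ℕ} (hs : OneBoxShift α β a b) (hX : IsSSSet α a b X)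
    (i m : ℕ) (him : i ≠ m) : rowContent α (tableauOfSet α a b X) i m =
      if (a ≤ i ∧ i < b ∧ i ∈ X ∧ nextIn X b i = m) then 1 else 0 := by
  classical
  have hab := hs.a_lt_b
  have ha := hs.a_pos
  unfold rowContent
  split_ifs with h
  · rw [Finset.card_eq_one]
    refine ⟨α.parts i, ?_⟩
    have hpos := parts_pos hs (show 0 < i by omega) h.2.1
    ext c
    simp only [Finset.mem_filter, Finset.mem_Icc, Finset.mem_singleton]
    constructor
    · rintro ⟨h1, h2⟩
      by_contra hc
      rw [tab_apply hX (cells_row_pos h1.1 h1.2), if_neg (by tauto)] at h2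
      exact him h2
    · rintro rfl
      refine ⟨by omega, ?_⟩
      rw [tab_apply hX (cells_row_pos hpos le_rfl), if_pos ⟨h.2.2.1, rfl⟩]
      exact h.2.2.2
  · rw [Finset.card_eq_zero, Finset.filter_eq_empty_iff]
    intro c hc h2
    rw [Finset.mem_Icc] at hc
    rw [tab_apply hX (cells_row_pos hc.1 hc.2)] at h2
    split_ifs at h2 with h3
    · have := hX.2.1 i h3.1
      exact h ⟨this.1, by omega, h3.1, h2⟩
    · exact him h2

lemma pred_count {X : Finset ℕ} (hab : a < b) (hX : IsSSSet α a b X) (j : ℕ) :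
    (X.filter fun u => nextIn X b u = j).card + (if j = a then 1 else 0) =
      (if j ∈ X then 1 else 0) + (if j = b then 1 else 0) := by
  classical
  have hbX : b ∉ X := fun h => by have := hX.2.1 b h; omega
  by_cases hj : j ≠ a ∧ (j ∈ X ∨ j = b)
  · have haj : a < j := by
      rcases hj.2 with h | h
      · have := hX.2.1 j h; omega
      · omega
    have hjb : j ≤ b := by
      rcases hj.2 with h | h
      · have := hX.2.1 j h; omega
      · omega
    have h1 : (X.filter fun u => nextIn X b u = j).card = 1 := by
      have hne : (X.filter fun u => u < j).Nonempty := ⟨a, by simp [hX.1, haj]⟩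
      rw [Finset.card_eq_one]
      have hmax := Finset.max'_mem _ hne
      have hle := Finset.le_max' (X.filter fun u => u < j)
      set m := (X.filter fun u => u < j).max' hne
      rw [Finset.mem_filter] at hmax
      refine ⟨m, ?_⟩
      ext u
      simp only [Finset.mem_filter, Finset.mem_singleton]
      constructor
      · rintro ⟨hu, hn⟩
        have hub := hX.2.1 u hu
        have hlt := lt_nextIn (X := X) (show u < b by omega)
        have := hle u (Finset.mem_filter.mpr ⟨hu, by omega⟩)
        by_contra hum
        have := (nextIn_spec X b u).2.1 m hmax.1 (by omega)
        omega
      · rintro rfl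
        refine ⟨hmax.1, ?_⟩
        apply nextIn_eq
        · rcases hj.2 with h | h
          · exact Or.inl ⟨h, hmax.2⟩
          · exact Or.inr h
        · intro v hv hlt
          by_contra hc
          have := hle v (Finset.mem_filter.mpr ⟨hv, by omega⟩)
          omega
        · exact hjb
    rw [h1, if_neg hj.1]
    rcases hj.2 with h | h
    · rw [if_pos h, if_neg (fun h' : j = b => hbX (h' ▸ h))]
    · rw [if_pos h, if_neg (fun h' : j ∈ X => hbX (h ▸ h'))]
  · have h0 : (X.filter fun u => nextIn X b u = j).card = 0 := by
      rw [Finset.card_eq_zero, Finset.filter_eq_empty_iff]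
      rintro u hu rfl
      have hub := hX.2.1 u hu
      have hlt := lt_nextIn (X := X) (show u < b by omega)
      apply hj
      refine ⟨by omega, ?_⟩
      rcases (nextIn_spec X b u).1 with h | h
      · exact Or.inl h.1
      · exact Or.inr h
    rw [h0]
    by_cases hja : j = a
    · subst hja
      rw [if_pos rfl, if_pos hX.1, if_neg (by omega)]
    · rw [if_neg hja, if_neg (fun h => hj ⟨hja, Or.inl h⟩), if_neg (fun h => hj ⟨hja, Or.inr h⟩)]

lemma card_row (α : Partition n) (j : ℕ) :
    ((cellFinset α).filter fun c => c.1 = j).card = α.parts j := by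
  have h := rowContent_eq α (fun _ => 0) j 0
  simpa [rowContent] using h

lemma shift_parts (hs : OneBoxShift α β a b) (j : ℕ) :
    β.parts j + (if j = a then 1 else 0) = α.parts j + (if j = b then 1 else 0) := by
  have hab := hs.a_lt_b
  have hr := hs.rem
  by_cases h1 : j = a
  · subst h1
    rw [hs.at_a, if_pos rfl, if_neg (by omega)]; omega
  · by_cases h2 : j = b
    · subst h2
      rw [hs.at_b, if_neg h1, if_pos rfl]
    · rw [if_neg h1, if_neg h2, hs.elsewhere j h1 h2]

lemma tab_type {X : Finset ℕ} (hs : OneBoxShift α β a b) (hX : IsSSSet α a b X) :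
    IsTypeOf α β.parts (tableauOfSet α a b X) := by
  classical
  have hab := hs.a_lt_b
  have ha := hs.a_pos
  intro j
  set T := tableauOfSet α a b X with hT
  have e1 := Finset.card_filter_add_card_filter_not
    (s := (cellFinset α).filter fun c => T c = j) (fun c => c.1 = j)
  have e2 := Finset.card_filter_add_card_filter_not
    (s := (cellFinset α).filter fun c => c.1 = j) (fun c => T c = j)
  simp only [Finset.filter_filter] at e1 e2
  rw [card_row] at e2
  have e3 : ((cellFinset α).filter fun c => T c = j ∧ c.1 = j).card =
      ((cellFinset α).filter fun c => c.1 = j ∧ T c = j).card := by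
    simp only [and_comm]
  have e4 : ((cellFinset α).filter fun c => c.1 = j ∧ ¬ T c = j).card =
      if j ∈ X then 1 else 0 := by
    split_ifs with hj
    · have hjb := hX.2.1 j hj
      have hpos := parts_pos hs (show 0 < j by omega) (by omega)
      rw [Finset.card_eq_one]
      refine ⟨(j, α.parts j), ?_⟩
      ext ⟨i, c⟩
      simp only [Finset.mem_filter, mem_cellFinset, Finset.mem_singleton, Prod.mk.injEq]
      constructor
      · rintro ⟨h1, rfl, h3⟩
        refine ⟨rfl, ?_⟩
        by_contra hc
        rw [hT, tab_apply hX h1, if_neg (by tauto)] at h3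
        exact h3 rfl
      · rintro ⟨rfl, rfl⟩
        have hm := cells_row_pos (α := α) hpos le_rfl
        refine ⟨hm, rfl, ?_⟩
        rw [hT, tab_apply hX hm, if_pos ⟨hj, rfl⟩]
        have := lt_nextIn (X := X) (show i < b by omega)
        omega
    · rw [Finset.card_eq_zero, Finset.filter_eq_empty_iff]
      rintro ⟨i, c⟩ hc ⟨rfl, h2⟩
      rw [mem_cellFinset] at hc
      rw [hT, tab_apply hX hc, if_neg (by tauto)] at h2
      exact h2 rfl
  have e5 : ((cellFinset α).filter fun c => T c = j ∧ ¬ c.1 = j).card =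
      (X.filter fun u => nextIn X b u = j).card := by
    symm
    apply Finset.card_bij (fun u _ => (u, α.parts u))
    · intro u hu
      simp only [Finset.mem_filter, mem_cellFinset] at hu ⊢
      have hub := hX.2.1 u hu.1
      have hpos := parts_pos hs (show 0 < u by omega) (by omega)
      have hm := cells_row_pos (α := α) hpos le_rfl
      have := lt_nextIn (X := X) (show u < b by omega)
      refine ⟨hm, ?_, by omega⟩
      rw [hT, tab_apply hX hm, if_pos ⟨hu.1, rfl⟩, hu.2]
    · intro u _ v _ h
      exact (Prod.ext_iff.mp h).1
    · rintro ⟨i, c⟩ hc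
      simp only [Finset.mem_filter, mem_cellFinset] at hc
      obtain ⟨h1, h2, h3⟩ := hc
      rw [hT, tab_apply hX h1] at h2
      split_ifs at h2 with h4
      · exact ⟨i, by simp [h4.1, h2], by rw [h4.2]⟩
      · exact absurd h2 h3
  have e6 := pred_count hab hX j
  have e7 := shift_parts hs j
  omega

lemma mem_Tset {T : ℕ × ℕ → ℕ} {u : ℕ} :
    u ∈ Tset α a b T ↔ (a ≤ u ∧ u ≤ b - 1) ∧ T (u, α.parts u) ≠ u := by
  rw [Tset, Finset.mem_filter, Finset.mem_Icc]
  rfl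

lemma tab_Tset {X : Finset ℕ} (hs : OneBoxShift α β a b) (hX : IsSSSet α a b X) :
    Tset α a b (tableauOfSet α a b X) = X := by
  have hab := hs.a_lt_b
  have ha := hs.a_pos
  ext u
  rw [mem_Tset]
  constructor
  · rintro ⟨h1, h2⟩
    by_contra hu
    have hpos := parts_pos hs (show 0 < u by omega) (by omega)
    rw [tab_apply hX (cells_row_pos hpos le_rfl), if_neg (by tauto)] at h2
    exact h2 rfl
  · intro hu
    have hub := hX.2.1 u hu
    have hpos := parts_pos hs (show 0 < u by omega) (by omega)
    refine ⟨hub, ?_⟩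
    rw [tab_apply hX (cells_row_pos hpos le_rfl), if_pos ⟨hu, rfl⟩]
    have := lt_nextIn (X := X) (show u < b by omega)
    omega

lemma tab_mem {X : Finset ℕ} (hs : OneBoxShift α β a b) (hX : IsSSSet α a b X) :
    tableauOfSet α a b X ∈ sstFinset α β := by
  rw [sstFinset, Set.Finite.mem_toFinset]
  refine ⟨tab_semistandard hs hX, tab_type hs hX, ?_⟩
  intro c hc
  simp [tableauOfSet, hc]

lemma sst_row_le {T : ℕ × ℕ → ℕ} (hT : T ∈ SSTSet α β.parts) {i c : ℕ}
    (h : (i, c) ∈ α.cells) : i ≤ T (i, c) := by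
  induction i with
  | zero => exact Nat.zero_le _
  | succ i ih =>
    rcases Nat.eq_zero_or_pos i with h0 | h0
    · subst h0
      have h1 := hT.2.1 (T (0 + 1, c))
      have h2 : 0 < ((cellFinset α).filter fun cc => T cc = T (0 + 1, c)).card :=
        Finset.card_pos.mpr ⟨_, Finset.mem_filter.mpr ⟨mem_cellFinset.mpr h, rfl⟩⟩
      rw [h1] at h2
      by_contra hc
      have h3 : T (0 + 1, c) = 0 := by omega
      rw [h3, β.parts_zero] at h2
      omega
    · have h1 : (i, c) ∈ α.cells := ⟨h0, h.2.1, h.2.2.trans (α.antitone h0 (by simp))⟩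
      have h2 := hT.1.2 i (i + 1) c h1 h (by omega)
      have := ih h1
      omega

lemma sst_N {T : ℕ × ℕ → ℕ} (hs : OneBoxShift α β a b) (hT : T ∈ SSTSet α β.parts) (v : ℕ) :
    ((cellFinset α).filter fun c => c.1 ≤ v ∧ v < T c).card =
      if a ≤ v ∧ v < b then 1 else 0 := by
  classical
  have hab := hs.a_lt_b
  have e1 : ((cellFinset α).filter fun c => T c ≤ v).card =
      ∑ w ∈ Finset.range (v + 1), β.parts w := by
    rw [Finset.card_eq_sum_card_fiberwise (f := T) (t := Finset.range (v + 1))]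
    · apply Finset.sum_congr rfl
      intro w hw
      rw [Finset.mem_range] at hw
      rw [← hT.2.1 w, Finset.filter_filter]
      congr 1
      ext c
      simp only [Finset.mem_filter]
      constructor
      · rintro ⟨h1, h2, h3⟩; exact ⟨h1, h3⟩
      · rintro ⟨h1, h2⟩; exact ⟨h1, by omega, h2⟩
    · intro c hc
      have := (Finset.mem_filter.mp (Finset.mem_coe.mp hc)).2
      simp only [Finset.coe_range, Set.mem_Iio]; omega
  have e2 : ((cellFinset α).filter fun c => c.1 ≤ v).card =
      ∑ w ∈ Finset.range (v + 1), α.parts w := by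
    rw [Finset.card_eq_sum_card_fiberwise (f := Prod.fst) (t := Finset.range (v + 1))]
    · apply Finset.sum_congr rfl
      intro w hw
      rw [Finset.mem_range] at hw
      rw [← card_row α w, Finset.filter_filter]
      congr 1
      ext c
      simp only [Finset.mem_filter]
      constructor
      · rintro ⟨h1, h2, h3⟩; exact ⟨h1, h3⟩
      · rintro ⟨h1, h2⟩; exact ⟨h1, by omega, h2⟩
    · intro c hc
      have := (Finset.mem_filter.mp (Finset.mem_coe.mp hc)).2
      simp only [Finset.coe_range, Set.mem_Iio]; omega
  have e3 := Finset.card_filter_add_card_filter_not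
    (s := (cellFinset α).filter fun c => c.1 ≤ v) (fun c => T c ≤ v)
  simp only [Finset.filter_filter, not_le] at e3
  have e4 : ((cellFinset α).filter fun c => c.1 ≤ v ∧ T c ≤ v) =
      (cellFinset α).filter fun c => T c ≤ v := by
    ext ⟨i, c⟩
    simp only [Finset.mem_filter, mem_cellFinset]
    constructor
    · rintro ⟨h1, h2, h3⟩; exact ⟨h1, h3⟩
    · rintro ⟨h1, h2⟩; exact ⟨h1, (sst_row_le hT h1).trans h2, h2⟩
  have e5 : ∑ w ∈ Finset.range (v + 1), β.parts w + (if a ≤ v then 1 else 0) =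
      ∑ w ∈ Finset.range (v + 1), α.parts w + (if b ≤ v then 1 else 0) := by
    have h := Finset.sum_congr (rfl : Finset.range (v + 1) = _) (fun w _ => shift_parts hs w)
    rw [Finset.sum_add_distrib, Finset.sum_add_distrib, Finset.sum_ite_eq', 
      Finset.sum_ite_eq'] at h
    simpa [Nat.lt_succ_iff] using h
  rw [e4, e1, e2] at e3
  split_ifs at e5 ⊢ <;> omega

lemma sst_surj {T : ℕ × ℕ → ℕ} (hs : OneBoxShift α β a b) (hT : T ∈ SSTSet α β.parts) :
    IsSSSet α a b (Tset α a b T) ∧ tableauOfSet α a b (Tset α a b T) = T := by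
  classical
  have hab := hs.a_lt_b
  have ha := hs.a_pos
  -- uniqueness of bad cells
  have huniq : ∀ v c c', c ∈ α.cells → c' ∈ α.cells → c.1 ≤ v → v < T c → c'.1 ≤ v → v < T c' →
      c = c' := by
    intro v c c' hc hc' h1 h2 h3 h4
    have hN := sst_N hs hT v
    have hle : ((cellFinset α).filter fun c => c.1 ≤ v ∧ v < T c).card ≤ 1 := by
      rw [hN]; split_ifs <;> omega
    rw [Finset.card_le_one] at hle
    exact hle c (by simp [mem_cellFinset, hc, h1, h2]) c' (by simp [mem_cellFinset, hc', h3, h4])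
  have hrange : ∀ v c, c ∈ α.cells → c.1 ≤ v → v < T c → a ≤ v ∧ v < b := by
    intro v c hc h1 h2
    have hN := sst_N hs hT v
    have hpos : 0 < ((cellFinset α).filter fun c => c.1 ≤ v ∧ v < T c).card :=
      Finset.card_pos.mpr ⟨c, by simp [mem_cellFinset, hc, h1, h2]⟩
    by_contra hc
    rw [hN, if_neg hc] at hpos
    omega
  have hexists : ∀ v, a ≤ v → v < b → ∃ c ∈ α.cells, c.1 ≤ v ∧ v < T c := by
    intro v h1 h2
    have hN := sst_N hs hT v
    rw [if_pos ⟨h1, h2⟩] at hN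
    obtain ⟨c, hc⟩ := Finset.card_pos.mp (by rw [hN]; exact Nat.one_pos)
    rw [Finset.mem_filter, mem_cellFinset] at hc
    exact ⟨c, hc⟩
  -- a bad cell is at the end of its row, and its row is in the set
  have hbad : ∀ i c, (i, c) ∈ α.cells → T (i, c) ≠ i →
      c = α.parts i ∧ i ∈ Tset α a b T := by
    intro i c hc hne
    have h1 := sst_row_le hT hc
    have hm : (i, α.parts i) ∈ α.cells := cells_row_pos (hc.2.1.trans_le hc.2.2) le_rfl
    have h2 := hT.1.1 i c (α.parts i) hc hm hc.2.2
    have h3 := huniq i (i, c) (i, α.parts i) hc hm le_rfl (by omega) le_rfl (by omega)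
    have h4 := hrange i (i, c) hc le_rfl (by omega)
    refine ⟨(Prod.ext_iff.mp h3).2, ?_⟩
    rw [mem_Tset]
    exact ⟨by omega, by omega⟩
  have hmem : ∀ u ∈ Tset α a b T, a ≤ u ∧ u < b ∧ (u, α.parts u) ∈ α.cells ∧
      u < T (u, α.parts u) := by
    intro u hu
    rw [mem_Tset] at hu
    have hpos := parts_pos hs (show 0 < u by omega) (by omega)
    have hm := cells_row_pos (α := α) hpos le_rfl
    have := sst_row_le hT hm
    exact ⟨hu.1.1, by omega, hm, by omega⟩
  have hnext : ∀ u ∈ Tset α a b T, nextIn (Tset α a b T) b u = T (u, α.parts u) := by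
    intro u hu
    obtain ⟨h1, h2, h3, h4⟩ := hmem u hu
    have h5 := hrange (T (u, α.parts u) - 1) _ h3 (by simp only; omega) (by omega)
    apply nextIn_eq
    · by_cases htb : T (u, α.parts u) = b
      · exact Or.inr htb
      · left
        refine ⟨?_, h4⟩
        obtain ⟨⟨i, c⟩, hc, hc1, hc2⟩ := hexists (T (u, α.parts u)) (by omega) (by omega)
        simp only at hc1
        have hi : i = T (u, α.parts u) := by
          by_contra hi
          have := huniq (T (u, α.parts u) - 1) (i, c) (u, α.parts u) hc h3
            (by simp only; omega) (by omega) (by simp only; omega) (by omega)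
          rw [this] at hc2
          omega
        have := (hbad i c hc (by omega)).2
        rwa [hi] at this
    · intro v hv huv
      by_contra hlt
      obtain ⟨k1, k2, k3, k4⟩ := hmem v hv
      have := huniq v (u, α.parts u) (v, α.parts v) h3 k3 huv.le (by omega) le_rfl k4
      have := (Prod.ext_iff.mp this).1
      simp only at this
      omega
    · omega
  have hSS : IsSSSet α a b (Tset α a b T) := by
    refine ⟨?_, ?_, ?_⟩
    · obtain ⟨⟨i, c⟩, hc, hc1, hc2⟩ := hexists a le_rfl hab
      simp only at hc1
      have h1 := hbad i c hc (by omega)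
      have h2 := hmem i h1.2
      have : i = a := by omega
      rw [← this]; rw [this] at h1 ⊢; exact h1.2
    · intro u hu
      have := hmem u hu
      omega
    · intro u hu heq
      obtain ⟨h1, h2, h3, h4⟩ := hmem u hu
      have h5 : (u + 1, α.parts u) ∈ α.cells := cells_row_pos h3.2.1 (by rw [heq])
      have h6 := hT.1.2 u (u + 1) (α.parts u) h3 h5 (by omega)
      exact (hbad (u + 1) (α.parts u) h5 (by omega)).2
  refine ⟨hSS, ?_⟩
  funext ⟨i, c⟩
  by_cases hc : (i, c) ∈ α.cells
  · rw [tab_apply hSS hc]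
    split_ifs with h
    · rw [hnext i h.1, h.2]
    · by_contra hne
      have := hbad i c hc (fun h' => hne h'.symm)
      exact h ⟨this.2, this.1⟩
  · rw [hT.2.2 _ hc]
    simp [tableauOfSet, hc]

lemma setWt_notSS {X : Finset ℕ} (hs : OneBoxShift α β a b) (hXsub : X ⊆ Finset.Ico a b)
    (haX : a ∈ X) (hX : ¬ IsSSSet α a b X) :
    setWt (fun i => α.parts (i + 1) < α.parts i) (hook α b) b a X = 0 := by
  have : ∃ u ∈ X, α.parts (u + 1) = α.parts u ∧ u + 1 ∉ X := by
    by_contra hc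
    push Not at hc
    apply hX
    refine ⟨haX, fun u hu => ?_, hc⟩
    have := Finset.mem_Ico.mp (hXsub hu)
    omega
  obtain ⟨u, hu, h1, h2⟩ := this
  apply Finset.prod_eq_zero (hXsub hu)
  simp [locWt, hu, h1, h2]

lemma setWt_SS {X : Finset ℕ} (hs : OneBoxShift α β a b) (hX : IsSSSet α a b X) :
    setWt (fun i => α.parts (i + 1) < α.parts i) (hook α b) b a X =
      cpCoeff α a b (tableauOfSet α a b X) := by
  classical
  have hab := hs.a_lt_b
  have ha := hs.a_pos
  unfold cpCoeff
  rw [tab_Tset hs hX]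
  have h1 : setWt (fun i => α.parts (i + 1) < α.parts i) (hook α b) b a X =
      ∏ u ∈ Finset.Ico a b, if u ∈ X then -1 else
        (if α.parts (u + 1) < α.parts u then hook α b u else 1) := by
    apply Finset.prod_congr rfl
    intro u hu
    unfold locWt
    split_ifs with h1 h2 h3 <;> try rfl
    exfalso
    apply h2
    have h4 := hX.2.1 u h1
    have h5 := α.antitone (show 0 < u by omega) (show u ≤ u + 1 by omega)
    by_cases h6 : α.parts (u + 1) = α.parts u
    · exact Or.inr (hX.2.2 u h1 h6)
    · left; omega
  rw [h1, Finset.prod_ite, Finset.prod_const]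
  congr 1
  · congr 2
    ext u
    simp only [Finset.mem_filter, Finset.mem_Ico, and_iff_right_iff_imp]
    intro hu
    have := hX.2.1 u hu
    omega
  · rw [← Finset.prod_filter, Finset.filter_filter]
    apply Finset.prod_congr _ (fun _ _ => rfl)
    ext u
    simp only [Finset.mem_filter, Finset.mem_Ico, Finset.mem_sdiff, Rset, Finset.mem_Icc]
    constructor
    · rintro ⟨h1, h2, h3⟩; exact ⟨⟨by omega, h3⟩, h2⟩
    · rintro ⟨⟨h1, h2⟩, h3⟩; exact ⟨by omega, h3, h2⟩

lemma theta_sum (hs : OneBoxShift α β a b) (x : ↥(Specht ℤ α)) :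
    emb β.parts ((∑ T ∈ sstFinset α β, (cpCoeff α a b T) • thetaHat ℤ α β.parts T) x) =
      bigG (fun i => α.parts (i + 1) < α.parts i) (hook α b) (rowOp n) (emb α.parts x.1) b a := by
  classical
  have hab := hs.a_lt_b
  rw [bigG, if_pos hab]
  have hsub : ∀ X ∈ (Finset.Ico (a + 1) b).powerset, insert a X ⊆ Finset.Ico a b := by
    intro X hX
    rw [Finset.mem_powerset] at hX
    intro u hu
    rcases Finset.mem_insert.mp hu with h | h
    · rw [h, Finset.mem_Ico]; omega
    · have := Finset.mem_Ico.mp (hX h)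
      rw [Finset.mem_Ico]; omega
  rw [← Finset.sum_filter_of_ne (p := fun X => IsSSSet α a b (insert a X))]
  swap
  · intro X hX hne
    by_contra hc
    apply hne
    rw [setWt_notSS hs (hsub X hX) (Finset.mem_insert_self _ _) hc, zero_smul]
  rw [LinearMap.sum_apply, map_sum]
  symm
  apply Finset.sum_bij (fun X _ => tableauOfSet α a b (insert a X))
  · intro X hX
    exact tab_mem hs (Finset.mem_filter.mp hX).2
  · intro X hX Y hY h
    rw [Finset.mem_filter, Finset.mem_powerset] at hX hY
    have h1 := congrArg (Tset α a b) h
    rw [tab_Tset hs hX.2, tab_Tset hs hY.2] at h1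
    have haX : a ∉ X := fun h => by have := Finset.mem_Ico.mp (hX.1 h); omega
    have haY : a ∉ Y := fun h => by have := Finset.mem_Ico.mp (hY.1 h); omega
    rw [← Finset.erase_insert haX, h1, Finset.erase_insert haY]
  · intro T hT
    rw [sstFinset, Set.Finite.mem_toFinset] at hT
    obtain ⟨h1, h2⟩ := sst_surj hs hT
    have h3 : insert a ((Tset α a b T).erase a) = Tset α a b T := Finset.insert_erase h1.1
    refine ⟨(Tset α a b T).erase a, ?_, by rw [h3, h2]⟩
    rw [Finset.mem_filter, Finset.mem_powerset, h3]
    refine ⟨?_, h1⟩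
    intro u hu
    rw [Finset.mem_erase] at hu
    have := h1.2.1 u hu.2
    rw [Finset.mem_Ico]
    omega
  · intro X hX
    have hX' := (Finset.mem_filter.mp hX).2
    rw [setWt_SS hs hX', LinearMap.smul_apply, map_smul]
    congr 1
    exact (emb_theta_eq α β.parts _ (tab_type hs hX') (insert a X) hab.le
      (rowContent_tab hs hX') x.1).symm

end SST
/-- Let `β` be a one-box-shift of `α` (box moved from row `a` to row
`b`), and let `θ̂ := Σ_T ((-1)^{|T|} ∏_{u ∈ {R}∖{T}} h_u) θ̂_T : S^α → M^β` be defined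
over `ℤ`, summing over all semistandard `α`-tableaux `T` of type `β`.  Let `γ` be the
composition `(α_1, …, α_a, α_{a+1} - 1, α_{a+2}, …, α_{b-1}, α_b + 1, α_{b+1}, …)`, so
that `ψ_a := ψ_{a, β_{a+1}-1}` maps `M^β` to `M^γ`.  Then the image of `θ̂ ∘ ψ_a` is
contained in `h_a • M_ℤ^γ`. -/
theorem stmt19 {n : ℕ} (α β : Partition n) (a b : ℕ) (hshift : OneBoxShift α β a b)
    (γ : ℕ → ℕ) (hγ : γ = nuComp β.parts a (β.parts (a + 1) - 1)) :
    ∀ x : ↥(Specht ℤ α), ∃ y : PermMod ℤ n (nuComp β.parts a (β.parts (a + 1) - 1)),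
      (psi ℤ β.parts a (β.parts (a + 1) - 1))
          ((∑ T ∈ sstFinset α β, (cpCoeff α a b T) • thetaHat ℤ α β.parts T) x) =
        hook α b a • y := by

  classical
  intro x
  have hab := hshift.a_lt_b
  have ha := hshift.a_pos
  have hpos : 0 < β.parts (a + 1) := by
    by_cases hb : b = a + 1
    · rw [← hb, hshift.at_b]; omega
    · rw [hshift.elsewhere (a + 1) (by omega) (by omega)]
      exact parts_pos hshift (by omega) (by omega)
  have hmain := bigMain (fun i => α.parts (i + 1) < α.parts i) (hook α b) (rowOp_glRel n)
    (emb α.parts x.1) hab hshift.rem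
    (by
      have := hshift.add
      have hb : b - 1 + 1 = b := by omega
      simpa only [hb] using this)
    (α.parts a : ℤ) (α.parts (a + 1) : ℤ)
    (by
      intro j hj hjb hR
      have h1 := α.antitone (show 0 < j by omega) (show j ≤ j + 1 by omega)
      have h2 : α.parts (j + 1) = α.parts j := by omega
      have h3 : j + 1 < b := by
        by_contra hc
        have h4 : j + 1 = b := by omega
        have h5 := hshift.add
        have h6 : b - 1 = j := by omega
        rw [h6, ← h4] at h5
        omega
      unfold hook
      rw [if_pos hjb, if_pos h3, h2]
      push_cast
      ring)
    (by
      intro j hj hjb hR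
      exact rowOp_specht (by omega) (by omega) (by omega) (not_lt.mp hR) x)
    (rowOp_specht (by omega) (by omega) ha (α.antitone ha (by omega)) x)
    (rowOp_weight _ _ _) (rowOp_weight _ _ _)
    (by
      intro h
      unfold hook
      rw [if_pos hab, if_pos h]
      push_cast
      ring)
    (by
      intro h
      unfold hook
      rw [if_pos hab, h]
      push_cast
      ring)
  refine ⟨Finsupp.equivFunOnFinite.symm fun g =>
    (- bigG (fun i => α.parts (i + 1) < α.parts i) (hook α b) (rowOp n)
      (emb α.parts x.1) b (a + 1)) g.1, ?_⟩
  ext g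
  rw [psi_emb β.parts a hpos, theta_sum hshift, hmain]
  rfl

end CarterPayne
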